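/- arXiv:2512.19312 — 2 statements merged into one kernel-verified Lean document; each statement's English description precedes it below -/
import Mathlib

section
/- (Gallai) For every finite simple undirected graph G there exists a partition V(G) = V₁ ⊔ V₂ such that every vertex of V₁ has even degree in the induced subgraph G[V₁] and every vertex of V₂ has even degree in the induced subgraph G[V₂]. -/
/-- Over `ZMod 2`, the quadratic form of a symmetric matrix is the linear form given by its
diagonal. -/
theorem Matrix.IsSymm.dotProduct_mulVec_zmod_two {ι : Type*} [Fintype ι] [DecidableEq ι]
    {M : Matrix ι ι (ZMod 2)} (hM : M.IsSymm) (y : ι → ZMod 2) :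
    y ⬝ᵥ M.mulVec y = y ⬝ᵥ M.diag := by
  have hsq : ∀ a b : ZMod 2, a * (b * a) = a * b := by decide
  have hoff : ∑ p : ι × ι, (if p.1 = p.2 then 0 else y p.1 * (M p.1 p.2 * y p.2)) = 0 := by
    refine Finset.sum_involution (fun p _ => p.swap) ?_ ?_ (by simp) (by simp)
    · rintro ⟨i, j⟩ -
      by_cases h : i = j
      · simp [h]
      · have h' : ¬ j = i := fun e => h e.symm
        simp only [Prod.swap, h, h', if_false, hM.apply i j]
        rw [show y j * (M i j * y i) = y i * (M i j * y j) by ring]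
        exact CharTwo.add_self_eq_zero _
    · rintro ⟨i, j⟩ - h e
      simp_all
  have hsplit : ∀ i j, y i * (M i j * y j) =
      (if i = j then y i * M i i else 0) + if i = j then 0 else y i * (M i j * y j) := by
    intro i j
    by_cases h : i = j
    · subst h
      simp [hsq]
    · simp [h]
  rw [Fintype.sum_prod_type] at hoff
  simp only [dotProduct, Matrix.mulVec, Finset.mul_sum, Matrix.diag]
  rw [Finset.sum_congr rfl fun i _ => Finset.sum_congr rfl fun j _ => hsplit i j]
  simp only [Finset.sum_add_distrib]
  rw [hoff]
  simp

/-- The diagonal of a symmetric matrix over `ZMod 2` lies in its column space. -/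
theorem Matrix.IsSymm.exists_mulVec_eq_diag {ι : Type*} [Fintype ι] [DecidableEq ι]
    {M : Matrix ι ι (ZMod 2)} (hM : M.IsSymm) : ∃ x, M.mulVec x = M.diag := by
  by_contra hne
  have hnot : M.diag ∉ LinearMap.range M.mulVecLin := by
    rintro ⟨x, hx⟩
    exact hne ⟨x, hx⟩
  obtain ⟨f, hf, hle⟩ := Submodule.exists_le_ker_of_notMem hnot
  obtain ⟨y, rfl⟩ := (dotProductEquiv (ZMod 2) ι).surjective f
  have h0 : y ⬝ᵥ M.mulVec y = 0 := hle ⟨y, rfl⟩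
  exact hf ((hM.dotProduct_mulVec_zmod_two y).symm.trans h0)

/-- Gallai: every finite simple graph admits a partition `V = V₁ ⊔ V₂`
such that both induced subgraphs `G[V₁]` and `G[V₂]` have all degrees even. -/
theorem stmt_2 {V : Type*} [Fintype V] [DecidableEq V]
    (G : SimpleGraph V) [DecidableRel G.Adj] :
    ∃ V₁ : Finset V,
      (∀ v ∈ V₁, Even ((V₁.filter (fun w => G.Adj v w)).card)) ∧
      (∀ v ∈ V₁ᶜ, Even ((V₁ᶜ.filter (fun w => G.Adj v w)).card)) := by
  obtain ⟨x, hx⟩ := (G.isSymm_lapMatrix (R := ZMod 2)).exists_mulVec_eq_diag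
  have h01 : ∀ a : ZMod 2, a = if a = 1 then 1 else 0 := by decide
  have hne : ∀ a : ZMod 2, 1 - a = if ¬ a = 1 then 1 else 0 := by decide
  have key : ∀ v, (G.degree v : ZMod 2) * x v - ∑ w ∈ G.neighborFinset v, x w = G.degree v := by
    intro v
    have := congrFun hx v
    rw [SimpleGraph.lapMatrix_mulVec_apply] at this
    simpa [SimpleGraph.lapMatrix, SimpleGraph.degMatrix] using this
  refine ⟨Finset.univ.filter (fun v => x v = 1), fun v hv => ?_, fun v hv => ?_⟩
  · have hv1 : x v = 1 := by simpa using hv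
    have hk := key v
    rw [hv1, mul_one, sub_eq_self] at hk
    rw [← ZMod.natCast_eq_zero_iff_even, ← hk, Finset.sum_congr rfl (fun w _ => h01 (x w)),
      Finset.sum_boole]
    congr 2
    ext w
    simp [and_comm]
  · have hv0 : x v = 0 := by
      have hv1 : ¬ x v = 1 := by simpa using hv
      rw [h01 (x v), if_neg hv1]
    have hk : ∑ w ∈ G.neighborFinset v, (1 - x w) = 0 := by
      have := key v
      rw [hv0, mul_zero, zero_sub] at this
      rw [Finset.sum_sub_distrib, Finset.sum_const, G.card_neighborFinset_eq_degree,
        nsmul_one, ← this, CharTwo.neg_eq, CharTwo.sub_eq_add, CharTwo.add_self_eq_zero]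
    rw [← ZMod.natCast_eq_zero_iff_even, ← hk, Finset.sum_congr rfl (fun w _ => hne (x w)),
      Finset.sum_boole]
    congr 2
    ext w
    simp [and_comm]
end

section
/- Let q be an odd prime power, η the quadratic character of 𝔽_q (extended by η(0)=0), and f ∈ 𝔽_q[x] a monic polynomial of positive degree that is not a square of a polynomial, with d distinct roots in its splitting field. Then |∑_{c ∈ 𝔽_q} η(f(c))| ≤ (d−1)√q. -/
namespace HyperellipticBound

open Polynomial

section PoleOrder

variable {K : Type*} [Field K] {f : K[X]}

/-- The pole order at infinity of `a + b y`, where `y ^ 2 = f`: the degree of its norm. -/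
noncomputable def poleOrder (z : QuadraticAlgebra K[X] f 0) : ℕ := z.norm.natDegree

lemma norm_eq (z : QuadraticAlgebra K[X] f 0) : z.norm = z.re ^ 2 - f * z.im ^ 2 := by
  rw [QuadraticAlgebra.norm_def]; ring

lemma natDegree_mul_sq (hf : f ≠ 0) {b : K[X]} (hb : b ≠ 0) :
    (f * b ^ 2).natDegree = 2 * b.natDegree + f.natDegree := by
  rw [natDegree_mul hf (pow_ne_zero _ hb), natDegree_pow]; ring

lemma norm_natDegree_cases (hf : Odd f.natDegree) {z : QuadraticAlgebra K[X] f 0} (hz : z ≠ 0) :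
    z.norm ≠ 0 ∧ 2 * z.re.natDegree ≤ poleOrder z ∧
      (z.im ≠ 0 → 2 * z.im.natDegree + f.natDegree ≤ poleOrder z) := by
  have hf0 : f ≠ 0 := by rintro rfl; simp at hf
  unfold poleOrder
  rw [norm_eq]
  by_cases hb : z.im = 0
  · have ha : z.re ≠ 0 := fun ha ↦ hz (QuadraticAlgebra.ext ha hb)
    simp [hb, ha]
  have h1 : (z.re ^ 2).natDegree = 2 * z.re.natDegree := natDegree_pow _ _
  have h2 := natDegree_mul_sq hf0 hb
  have hne : 2 * z.re.natDegree ≠ 2 * z.im.natDegree + f.natDegree := by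
    obtain ⟨k, hk⟩ := hf; omega
  rcases lt_or_gt_of_ne hne with h | h
  · have h3 := natDegree_sub_eq_right_of_natDegree_lt (p := z.re ^ 2) (q := f * z.im ^ 2)
      (by omega)
    refine ⟨fun h0 ↦ ?_, by omega, fun _ ↦ by omega⟩
    rw [h0, natDegree_zero] at h3
    omega
  · have h3 := natDegree_sub_eq_left_of_natDegree_lt (p := z.re ^ 2) (q := f * z.im ^ 2)
      (by omega)
    refine ⟨fun h0 ↦ ?_, by omega, fun _ ↦ by omega⟩
    rw [h0, natDegree_zero] at h3
    omega

lemma poleOrder_le {z : QuadraticAlgebra K[X] f 0} {N : ℕ}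
    (h1 : 2 * z.re.natDegree ≤ N) (h2 : z.im ≠ 0 → 2 * z.im.natDegree + f.natDegree ≤ N) :
    poleOrder z ≤ N := by
  unfold poleOrder
  rw [norm_eq]
  refine (natDegree_sub_le _ _).trans (max_le ((natDegree_pow_le).trans h1) ?_)
  by_cases hb : z.im = 0
  · simp [hb]
  · exact natDegree_mul_le.trans <| (add_le_add_right natDegree_pow_le _).trans
      (by have := h2 hb; omega)

lemma poleOrder_zero : poleOrder (0 : QuadraticAlgebra K[X] f 0) = 0 := by
  simp [poleOrder]

lemma poleOrder_add_le (hf : Odd f.natDegree) {z w : QuadraticAlgebra K[X] f 0} {N : ℕ}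
    (hz : poleOrder z ≤ N) (hw : poleOrder w ≤ N) : poleOrder (z + w) ≤ N := by
  by_cases hz0 : z = 0
  · simpa [hz0]
  by_cases hw0 : w = 0
  · simpa [hw0]
  obtain ⟨-, hz1, hz2⟩ := norm_natDegree_cases hf hz0
  obtain ⟨-, hw1, hw2⟩ := norm_natDegree_cases hf hw0
  refine poleOrder_le ?_ fun h ↦ ?_
  · have := natDegree_add_le z.re w.re
    rw [QuadraticAlgebra.re_add]
    omega
  · have := natDegree_add_le z.im w.im
    rw [QuadraticAlgebra.im_add] at h ⊢
    by_cases hz3 : z.im = 0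
    · simp only [hz3, zero_add] at h ⊢
      exact (hw2 h).trans hw
    by_cases hw3 : w.im = 0
    · simp only [hw3, add_zero] at h ⊢
      exact (hz2 h).trans hz
    have := hz2 hz3
    have := hw2 hw3
    omega

lemma poleOrder_sum_le (hf : Odd f.natDegree) {ι : Type*} (t : Finset ι)
    (z : ι → QuadraticAlgebra K[X] f 0) {N : ℕ} (h : ∀ i ∈ t, poleOrder (z i) ≤ N) :
    poleOrder (∑ i ∈ t, z i) ≤ N := by
  classical
  induction t using Finset.induction_on with
  | empty => simp [poleOrder_zero]
  | insert a t ha ih =>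
    rw [Finset.sum_insert ha]
    exact poleOrder_add_le hf (h a (by simp)) (ih fun i hi ↦ h i (by simp [hi]))

lemma poleOrder_neg (z : QuadraticAlgebra K[X] f 0) : poleOrder (-z) = poleOrder z := by
  simp [poleOrder]

lemma poleOrder_mul_pow_le (z w : QuadraticAlgebra K[X] f 0) (n : ℕ) :
    poleOrder (z * w ^ n) ≤ poleOrder z + n * poleOrder w := by
  unfold poleOrder
  rw [map_mul, map_pow]
  exact natDegree_mul_le.trans (add_le_add_right natDegree_pow_le _)

lemma poleOrder_mul_pow (hf : Odd f.natDegree) {z w : QuadraticAlgebra K[X] f 0}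
    (hz : z ≠ 0) (hw : w ≠ 0) (n : ℕ) :
    poleOrder (z * w ^ n) = poleOrder z + n * poleOrder w := by
  unfold poleOrder
  rw [map_mul, map_pow, natDegree_mul (norm_natDegree_cases hf hz).1
    (pow_ne_zero _ (norm_natDegree_cases hf hw).1), natDegree_pow]

/-- If `g i` has pole order less than `s` and the `h i` have strictly increasing pole orders, then
no nontrivial sum `∑ g i * h i ^ s` vanishes. -/
lemma sum_mul_pow_ne_zero (hf : Odd f.natDegree) {M s : ℕ}
    (g h : Fin M → QuadraticAlgebra K[X] f 0) (hg : ∀ i, poleOrder (g i) < s)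
    (hh0 : ∀ i, h i ≠ 0) (hh : StrictMono fun i ↦ poleOrder (h i)) (hne : g ≠ 0) :
    ∑ i, g i * h i ^ s ≠ 0 := by
  classical
  intro hsum
  have hS : (Finset.univ.filter fun i ↦ g i ≠ 0).Nonempty := by
    obtain ⟨i, hi⟩ := Function.ne_iff.mp hne
    exact ⟨i, by simpa using hi⟩
  set i := (Finset.univ.filter fun i ↦ g i ≠ 0).max' hS with hi
  have hgi : g i ≠ 0 := by
    have := Finset.max'_mem _ hS
    rw [← hi] at this
    simpa using this
  have hle : ∀ j, g j ≠ 0 → j ≤ i := fun j hj ↦ Finset.le_max' _ _ (by simpa using hj)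
  rw [← Finset.add_sum_erase _ _ (Finset.mem_univ i)] at hsum
  have h1 := poleOrder_mul_pow hf hgi (hh0 i) s
  rw [eq_neg_of_add_eq_zero_left hsum, poleOrder_neg] at h1
  have hs : 0 < s := (Nat.zero_le _).trans_lt (hg i)
  have h2 : poleOrder (∑ j ∈ Finset.univ.erase i, g j * h j ^ s) ≤
      s * poleOrder (h i) - 1 := by
    refine poleOrder_sum_le hf _ _ fun j hj ↦ ?_
    by_cases hj0 : g j = 0
    · simp [hj0, poleOrder_zero]
    have hlt : j < i := lt_of_le_of_ne (hle j hj0) (Finset.ne_of_mem_erase hj)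
    have h3 : poleOrder (h j) + 1 ≤ poleOrder (h i) := hh hlt
    have h4 := Nat.mul_le_mul_left s h3
    have h5 := poleOrder_mul_pow_le (g j) (h j) s
    have h6 := hg j
    rw [mul_add] at h4
    omega
  by_cases hpos : poleOrder (h i) = 0
  · have hone : ∀ j, j ≠ i → g j = 0 := fun j hj ↦ by
      by_contra hj0
      have : poleOrder (h j) < poleOrder (h i) := hh (lt_of_le_of_ne (hle j hj0) hj)
      omega
    rw [Finset.sum_eq_zero fun j hj ↦ by simp [hone j (Finset.ne_of_mem_erase hj)]] at hsum
    have hn := congrArg QuadraticAlgebra.norm hsum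
    rw [add_zero, map_mul, map_pow, QuadraticAlgebra.norm_zero] at hn
    exact mul_ne_zero (norm_natDegree_cases hf hgi).1
      (pow_ne_zero _ (norm_natDegree_cases hf (hh0 i)).1) hn
  · have : 0 < s * poleOrder (h i) := by positivity
    omega

end PoleOrder

section Points

variable {K : Type*} [Field K] {f : K[X]}

/-- Evaluation of `a + b y` at the point `(c, e)` of the curve `y ^ 2 = f`. -/
noncomputable def evalPoint (c e : K) (h : e ^ 2 = f.eval c) : QuadraticAlgebra K[X] f 0 →+* K where
  toFun z := z.re.eval c + z.im.eval c * e
  map_one' := by rw [QuadraticAlgebra.re_one, QuadraticAlgebra.im_one]; simp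
  map_zero' := by rw [QuadraticAlgebra.re_zero, QuadraticAlgebra.im_zero]; simp
  map_add' z w := by
    simp only [QuadraticAlgebra.re_add, QuadraticAlgebra.im_add, eval_add]
    ring
  map_mul' z w := by
    simp only [QuadraticAlgebra.re_mul, QuadraticAlgebra.im_mul, eval_add, eval_mul, ← h,
      eval_zero]
    ring

lemma evalPoint_apply (c e : K) (h : e ^ 2 = f.eval c) (z : QuadraticAlgebra K[X] f 0) :
    evalPoint c e h z = z.re.eval c + z.im.eval c * e := rfl

variable [Fintype K] [DecidableEq K]

lemma card_zeros_fiber_le {z : QuadraticAlgebra K[X] f 0} (hz : z.norm ≠ 0)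
    (c : K) :
    (Finset.univ.filter fun e : K ↦ e ^ 2 = f.eval c ∧ z.re.eval c + z.im.eval c * e = 0).card ≤
      z.norm.rootMultiplicity c := by
  set S := Finset.univ.filter fun e : K ↦ e ^ 2 = f.eval c ∧ z.re.eval c + z.im.eval c * e = 0
    with hS
  have hmem : ∀ e, e ∈ S ↔ e ^ 2 = f.eval c ∧ z.re.eval c + z.im.eval c * e = 0 := by simp [hS]
  rcases S.eq_empty_or_nonempty with h | ⟨e, he⟩
  · simp [h]
  have he' := (hmem e).1 he
  by_cases hone : ∀ e' ∈ S, e' = e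
  · have : S.card ≤ 1 := Finset.card_le_one.2 fun a ha b hb ↦ (hone a ha).trans (hone b hb).symm
    refine this.trans ((rootMultiplicity_pos hz).2 ?_)
    rw [IsRoot.def, norm_eq, eval_sub, eval_mul, eval_pow, eval_pow, ← he'.1]
    linear_combination (z.re.eval c - z.im.eval c * e) * he'.2
  · push Not at hone
    obtain ⟨e', he1, hne⟩ := hone
    have he2 := (hmem e').1 he1
    have hneg : ∀ a ∈ S, a = e ∨ a = -e := fun a ha ↦
      sq_eq_sq_iff_eq_or_eq_neg.1 (((hmem a).1 ha).1.trans he'.1.symm)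
    have hcard : S.card ≤ 2 := by
      refine (Finset.card_le_card (t := {e, -e}) fun a ha ↦ ?_).trans Finset.card_le_two
      simpa using hneg a ha
    have hb : z.im.eval c = 0 := by
      have : z.im.eval c * (e' - e) = 0 := by linear_combination he2.2 - he'.2
      exact (mul_eq_zero.1 this).resolve_right (sub_ne_zero.2 hne)
    have ha : z.re.eval c = 0 := by simpa [hb] using he'.2
    refine hcard.trans ((le_rootMultiplicity_iff hz).2 ?_)
    obtain ⟨u, hu⟩ := dvd_iff_isRoot.2 ha
    obtain ⟨v, hv⟩ := dvd_iff_isRoot.2 hb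
    exact ⟨u ^ 2 - f * v ^ 2, by rw [norm_eq, hu, hv]; ring⟩

lemma card_zeros_le {z : QuadraticAlgebra K[X] f 0} (hz : z.norm ≠ 0) :
    (∑ c : K, (Finset.univ.filter fun e : K ↦
      e ^ 2 = f.eval c ∧ z.re.eval c + z.im.eval c * e = 0).card) ≤ poleOrder z := by
  calc _ ≤ ∑ c : K, z.norm.roots.count c := Finset.sum_le_sum fun c _ ↦ by
        rw [count_roots]; exact card_zeros_fiber_le hz c
    _ = z.norm.roots.card := Multiset.sum_count_eq_card fun _ _ ↦ Finset.mem_univ _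
    _ ≤ _ := card_roots' _

end Points

section Weak

variable {K : Type*} [Field K] [Fintype K] {f : K[X]}

lemma natCard_degreeLT (n : ℕ) : Nat.card (degreeLT K n) = Fintype.card K ^ n := by
  rw [Nat.card_congr (degreeLTEquiv K n).toEquiv]
  simp

instance finite_degreeLT (n : ℕ) : Finite (degreeLT K n) :=
  Finite.of_equiv _ (degreeLTEquiv K n).toEquiv.symm

/-- Functions of strictly increasing pole order `f.natDegree + i`. -/
noncomputable def monomialFn (f : K[X]) (i : ℕ) : QuadraticAlgebra K[X] f 0 :=
  if Even (f.natDegree + i) then ⟨X ^ ((f.natDegree + i) / 2), 0⟩ else ⟨0, X ^ (i / 2)⟩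

omit [Fintype K] in
lemma monomialFn_ne_zero (i : ℕ) : monomialFn f i ≠ 0 := by
  unfold monomialFn
  split_ifs <;> simp [QuadraticAlgebra.ext_iff]

omit [Fintype K] in
lemma poleOrder_monomialFn (hf : Odd f.natDegree) (i : ℕ) :
    poleOrder (monomialFn f i) = f.natDegree + i := by
  have hf0 : f ≠ 0 := by rintro rfl; simp at hf
  unfold poleOrder monomialFn
  rw [norm_eq]
  split_ifs with h
  · simp only [ne_eq, OfNat.ofNat_ne_zero, not_false_eq_true, zero_pow, mul_zero, sub_zero,
      natDegree_pow, natDegree_X, mul_one]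
    obtain ⟨k, hk⟩ := h
    omega
  · simp only [ne_eq, OfNat.ofNat_ne_zero, not_false_eq_true, zero_pow, zero_sub, natDegree_neg]
    rw [natDegree_mul_sq hf0 (pow_ne_zero _ X_ne_zero), natDegree_X_pow]
    rw [Nat.not_even_iff_odd] at h
    obtain ⟨k, hk⟩ := h
    obtain ⟨l, hl⟩ := hf
    omega

/-- A nontrivial relation `∑ g i ^ s * h i = 0`, by counting. -/
lemma exists_relation (p k s : ℕ) [Fact p.Prime] [CharP K p] (hs : s = p ^ k)
    (hs_odd : Odd s) (hf : Odd f.natDegree) (hbig : (f.natDegree + 2) ^ 2 < s) :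
    ∃ g : Fin (s + f.natDegree) → QuadraticAlgebra K[X] f 0, g ≠ 0 ∧ (∀ i, poleOrder (g i) < s) ∧
      ∑ i, g i ^ s * monomialFn f i = 0 := by
  classical
  set m := f.natDegree with hm
  obtain ⟨D, hD⟩ : ∃ D, s = m + 2 * D := by
    obtain ⟨a, ha⟩ := hs_odd
    obtain ⟨b, hb⟩ := hf
    refine ⟨(s - m) / 2, ?_⟩
    have : m < s := by nlinarith
    omega
  have hDpos : 0 < D := by
    rcases Nat.eq_zero_or_pos D with h | h
    · subst h; nlinarith
    · exact h
  set T := s * (s - 2) + (m + (s + m)) with hT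
  let V := degreeLT K D
  let W := degreeLT K (T / 2 + 1)
  let toQ : V × V → QuadraticAlgebra K[X] f 0 := fun v ↦ ⟨v.1, v.2⟩
  have htoQ : ∀ v, poleOrder (toQ v) ≤ s - 2 := by
    intro v
    have h1 : (v.1 : K[X]).natDegree < D := by
      by_cases h0 : (v.1 : K[X]) = 0
      · simpa [h0]
      · exact (natDegree_lt_iff_degree_lt h0).2 (mem_degreeLT.1 v.1.2)
    have h2 : (v.2 : K[X]).natDegree < D := by
      by_cases h0 : (v.2 : K[X]) = 0
      · simpa [h0]
      · exact (natDegree_lt_iff_degree_lt h0).2 (mem_degreeLT.1 v.2.2)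
    refine poleOrder_le ?_ fun _ ↦ ?_ <;> simp only [toQ] <;> omega
  have hsub : ∀ v w, toQ (v - w) = toQ v - toQ w := fun v w ↦ by
    simp [toQ]
  let Φ : (Fin (s + m) → V × V) → QuadraticAlgebra K[X] f 0 :=
    fun v ↦ ∑ i, toQ (v i) ^ s * monomialFn f i
  have hΦ : ∀ v, poleOrder (Φ v) ≤ T := by
    intro v
    refine poleOrder_sum_le hf _ _ fun i _ ↦ ?_
    rw [mul_comm]
    refine (poleOrder_mul_pow_le _ _ _).trans ?_
    rw [poleOrder_monomialFn hf]
    have := Nat.mul_le_mul_left s (htoQ (v i))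
    have := i.2
    omega
  have hmem : ∀ z : QuadraticAlgebra K[X] f 0, poleOrder z ≤ T →
      z.re ∈ degreeLT K (T / 2 + 1) ∧ z.im ∈ degreeLT K (T / 2 + 1) := by
    intro z hz
    by_cases hz0 : z = 0
    · subst hz0; simp
    obtain ⟨-, h1, h2⟩ := norm_natDegree_cases hf hz0
    constructor <;> rw [mem_degreeLT]
    · exact degree_le_natDegree.trans_lt (by exact_mod_cast (by omega))
    · by_cases hb : z.im = 0
      · simp [hb]
      · have := h2 hb
        exact degree_le_natDegree.trans_lt (by exact_mod_cast (by omega))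
  let Ψ : (Fin (s + m) → V × V) → W × W :=
    fun v ↦ (⟨(Φ v).re, (hmem _ (hΦ v)).1⟩, ⟨(Φ v).im, (hmem _ (hΦ v)).2⟩)
  have hΨ : ∀ v w, Ψ v = Ψ w → Φ v = Φ w := by
    intro v w h
    rw [Prod.ext_iff] at h
    exact QuadraticAlgebra.ext (congrArg Subtype.val h.1) (congrArg Subtype.val h.2)
  have hcard : Nat.card (W × W) < Nat.card (Fin (s + m) → V × V) := by
    rw [Nat.card_fun, Nat.card_prod, Nat.card_prod, natCard_degreeLT, natCard_degreeLT,
      Nat.card_fin, ← pow_add, ← pow_add, ← pow_mul]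
    refine Nat.pow_lt_pow_right Fintype.one_lt_card ?_
    have h3 : T + 2 < (D + D) * (s + m) := by
      have e1 : s * (s - 2) + 2 * s = s * s := by
        obtain ⟨t, rfl⟩ : ∃ t, s = t + 2 := ⟨s - 2, by omega⟩
        rw [Nat.add_sub_cancel]
        ring
      have e2 : (D + D) * (s + m) + m * m = s * s := by rw [hD]; ring
      nlinarith
    omega
  obtain ⟨v, w, hvw, hne⟩ : ∃ v w, Ψ v = Ψ w ∧ v ≠ w := by
    by_contra! hinj
    exact absurd (Nat.card_le_card_of_injective Ψ fun v w h ↦ hinj v w h) (not_le.2 hcard)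
  have : CharP (QuadraticAlgebra K[X] f 0) p := by
    have : Function.Injective (algebraMap K[X] (QuadraticAlgebra K[X] f 0)) :=
      FaithfulSMul.algebraMap_injective _ _
    exact charP_of_injective_algebraMap this p
  refine ⟨fun i ↦ toQ (v i - w i), fun h0 ↦ hne ?_, fun i ↦ ?_, ?_⟩
  · funext i
    have := congrFun h0 i
    simp only [toQ, Pi.zero_apply, QuadraticAlgebra.ext_iff] at this
    refine Prod.ext (Subtype.ext ?_) (Subtype.ext ?_)
    · simpa [sub_eq_zero] using this.1
    · simpa [sub_eq_zero] using this.2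
  · have := htoQ (v i - w i)
    dsimp only
    omega
  · have := hΨ v w hvw
    simp only [Φ] at this
    rw [← sub_eq_zero, ← Finset.sum_sub_distrib] at this
    rw [← this]
    refine Finset.sum_congr rfl fun i _ ↦ ?_
    have hfrob := sub_pow_char_pow (p := p) (toQ (v i)) (toQ (w i)) k
    rw [← hs] at hfrob
    dsimp only
    rw [hsub, ← sub_mul, hfrob]

/-- The number of points of `y ^ 2 = f` over a field of square order `s ^ 2`. -/
lemma card_points_le [DecidableEq K] (p k s : ℕ) [Fact p.Prime] [CharP K p] (hs : s = p ^ k)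
    (hs_odd : Odd s) (hQ : Fintype.card K = s ^ 2) (hf : Odd f.natDegree)
    (hbig : (f.natDegree + 2) ^ 2 < s) :
    (∑ c : K, (Finset.univ.filter fun e : K ↦ e ^ 2 = f.eval c).card) ≤
      s ^ 2 + (2 * f.natDegree + 1) * s := by
  obtain ⟨g, hg0, hg, hrel⟩ := exists_relation p k s hs hs_odd hf hbig
  set z := ∑ i, g i * monomialFn f i ^ s with hz
  have hz0 : z ≠ 0 := by
    refine sum_mul_pow_ne_zero hf g _ hg (fun i ↦ monomialFn_ne_zero _) (fun i j hij ↦ ?_) hg0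
    simpa only [poleOrder_monomialFn hf, add_lt_add_iff_left, Fin.val_fin_lt] using hij
  have hzle : poleOrder z ≤ s ^ 2 + (2 * f.natDegree + 1) * s := by
    refine poleOrder_sum_le hf _ _ fun i _ ↦ (poleOrder_mul_pow_le _ _ _).trans ?_
    rw [poleOrder_monomialFn hf]
    have := i.2
    have := hg i
    nlinarith
  refine le_trans (Finset.sum_le_sum fun c _ ↦ Finset.card_le_card fun e he ↦ ?_)
    ((card_zeros_le (norm_natDegree_cases hf hz0).1).trans hzle)
  have he' : e ^ 2 = f.eval c := by simpa using he
  refine Finset.mem_filter.2 ⟨Finset.mem_univ _, he', ?_⟩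
  rw [← evalPoint_apply c e he']
  have hs0 : s ≠ 0 := by rintro rfl; simp at hs_odd
  refine (pow_eq_zero_iff hs0).1 ?_
  have hfrob := sum_pow_char_pow (p := p) k Finset.univ
    fun i ↦ evalPoint c e he' (g i * monomialFn f i ^ s)
  rw [← hs] at hfrob
  rw [hz, map_sum, hfrob, ← map_zero (evalPoint c e he'), ← hrel, map_sum]
  refine Finset.sum_congr rfl fun i _ ↦ ?_
  simp only [map_mul, map_pow]
  rw [mul_pow, ← pow_mul, ← pow_two, ← hQ, FiniteField.pow_card]

end Weak

section QuadraticSum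

variable {K : Type*} [Field K] [Fintype K] [DecidableEq K] {f : K[X]}

omit [DecidableEq K] in
lemma ringChar_ne_two_of_odd (h : Odd (Fintype.card K)) : ringChar K ≠ 2 := fun h2 ↦
  (Nat.not_even_iff_odd.2 h) (Nat.even_iff.2 (FiniteField.even_card_of_char_two h2))

lemma sum_card_sqrt (h : Odd (Fintype.card K)) (f : K[X]) :
    (∑ c : K, (Finset.univ.filter fun e : K ↦ e ^ 2 = f.eval c).card : ℤ) =
      Fintype.card K + ∑ c : K, quadraticChar K (f.eval c) := by
  have : ∀ c : K, ((Finset.univ.filter fun e : K ↦ e ^ 2 = f.eval c).card : ℤ) =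
      quadraticChar K (f.eval c) + 1 := fun c ↦ by
    rw [← quadraticChar_card_sqrts (ringChar_ne_two_of_odd h)]
    congr 2
    ext
    simp
  simp_rw [this, Finset.sum_add_distrib]
  simp [add_comm]

lemma sum_quadraticChar_le (p k s : ℕ) [Fact p.Prime] [CharP K p] (hs : s = p ^ k)
    (hs_odd : Odd s) (hQ : Fintype.card K = s ^ 2) (hf : Odd f.natDegree)
    (hbig : (f.natDegree + 2) ^ 2 < s) :
    ∑ c : K, quadraticChar K (f.eval c) ≤ (2 * f.natDegree + 1) * s := by
  have h1 := card_points_le p k s hs hs_odd hQ hf hbig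
  have h2 := sum_card_sqrt (K := K) (by rw [hQ]; exact hs_odd.pow) f
  have h3 : (∑ c : K, (Finset.univ.filter fun e : K ↦ e ^ 2 = f.eval c).card : ℤ) ≤
      s ^ 2 + (2 * f.natDegree + 1) * s := by exact_mod_cast h1
  rw [h2, hQ] at h3
  push_cast at h3
  linarith

lemma abs_sum_quadraticChar_le_of_odd (p k s : ℕ) [Fact p.Prime] [CharP K p] (hs : s = p ^ k)
    (hs_odd : Odd s) (hQ : Fintype.card K = s ^ 2) (hf : Odd f.natDegree)
    (hbig : (f.natDegree + 2) ^ 2 < s) :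
    |∑ c : K, quadraticChar K (f.eval c)| ≤ (2 * f.natDegree + 1) * s := by
  refine abs_le.2 ⟨?_, sum_quadraticChar_le p k s hs hs_odd hQ hf hbig⟩
  obtain ⟨ν, hν⟩ := quadraticChar_exists_neg_one
    (ringChar_ne_two_of_odd (K := K) (by rw [hQ]; exact hs_odd.pow))
  have hν0 : ν ≠ 0 := by rintro rfl; simp at hν
  have hdeg : (C ν * f).natDegree = f.natDegree := natDegree_C_mul hν0
  have := sum_quadraticChar_le (f := C ν * f) p k s hs hs_odd hQ (by rwa [hdeg]) (by rwa [hdeg])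
  simp only [eval_mul, eval_C, map_mul, hν, hdeg, ← Finset.mul_sum] at this
  linarith

lemma exists_sum_eq_of_even {α : K} (hα : f.rootMultiplicity α = 1) (hf : Even f.natDegree) :
    ∃ h : K[X], h.natDegree + 1 = f.natDegree ∧
      ∑ c : K, quadraticChar K (f.eval c) =
        ∑ u : K, quadraticChar K (h.eval u) - quadraticChar K (h.eval 0) := by
  have hf0 : f ≠ 0 := by rintro rfl; simp at hα
  set g := f.comp (X + C α) with hg
  have hgdeg : g.natDegree = f.natDegree := by simp [hg, natDegree_comp]
  have hg0 : g.eval 0 = 0 := by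
    have : f.IsRoot α := (rootMultiplicity_pos hf0).1 (by omega)
    simpa [hg] using this
  have htrail : g.natTrailingDegree = 1 := by
    rw [← hα, rootMultiplicity_eq_natTrailingDegree]
  refine ⟨g.reverse, ?_, ?_⟩
  · have h0 : 0 < f.natDegree := by
      by_contra h
      have h1 : g.natTrailingDegree ≤ g.natDegree := natTrailingDegree_le_natDegree g
      omega
    rw [reverse_natDegree, htrail, hgdeg]
    omega
  have key : ∀ u : K, quadraticChar K (g.eval u⁻¹) =
      quadraticChar K (g.reverse.eval u) -
        if u = 0 then quadraticChar K (g.reverse.eval 0) else 0 := by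
    intro u
    by_cases hu : u = 0
    · subst hu; simp [hg0]
    rw [if_neg hu, sub_zero]
    let : Invertible (u⁻¹) := invertibleOfNonzero (inv_ne_zero hu)
    have := eval₂_reverse_mul_pow (RingHom.id K) u⁻¹ g
    simp only [invOf_eq_inv, inv_inv, eval₂_id] at this
    rw [← this, hgdeg, map_mul]
    obtain ⟨l, hl⟩ := hf
    rw [hl, ← two_mul, pow_mul', map_pow, quadraticChar_sq_one (by positivity), mul_one]
  calc ∑ c : K, quadraticChar K (f.eval c) = ∑ u : K, quadraticChar K (g.eval u) := by
        rw [← Equiv.sum_comp (Equiv.addRight α)]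
        simp [hg]
    _ = ∑ u : K, quadraticChar K (g.eval u⁻¹) := by
        rw [← Equiv.sum_comp (Equiv.inv K)]
        simp
    _ = _ := by
        simp_rw [key, Finset.sum_sub_distrib]
        simp

/-- Square-root cancellation, with a non-optimal constant, over fields of square order. -/
lemma abs_sum_quadraticChar_le (p k s : ℕ) [Fact p.Prime] [CharP K p] (hs : s = p ^ k)
    (hs_odd : Odd s) (hQ : Fintype.card K = s ^ 2) {α : K} (hα : f.rootMultiplicity α = 1)
    (hbig : (f.natDegree + 2) ^ 2 < s) :
    |∑ c : K, quadraticChar K (f.eval c)| ≤ (2 * f.natDegree + 2) * s := by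
  have hs1 : (1 : ℤ) ≤ s := by exact_mod_cast hs_odd.pos
  rcases Nat.even_or_odd f.natDegree with hf | hf
  · obtain ⟨h, hdeg, hsum⟩ := exists_sum_eq_of_even hα hf
    have hodd : Odd h.natDegree := by
      rw [← hdeg] at hf
      exact Nat.not_even_iff_odd.1 fun h' ↦ (Nat.even_add_one.1 hf) h'
    have h1 := abs_sum_quadraticChar_le_of_odd (f := h) p k s hs hs_odd hQ hodd (by nlinarith)
    have h2 : |quadraticChar K (h.eval 0)| ≤ 1 := by
      by_cases h0 : h.eval 0 = 0
      · simp [h0]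
      · rcases quadraticChar_dichotomy h0 with h | h <;> simp [h]
    rw [hsum]
    have h3 := abs_sub (∑ u : K, quadraticChar K (h.eval u)) (quadraticChar K (h.eval 0))
    rw [← hdeg]
    push_cast
    nlinarith
  · have := abs_sum_quadraticChar_le_of_odd p k s hs hs_odd hQ hf hbig
    linarith

end QuadraticSum

section PowerSums

lemma sum_coeff_mul_powerSum (s : Multiset ℂ) (P : ℂ[X]) (n : ℕ) :
    ∑ k ∈ Finset.range (P.natDegree + 1), P.coeff k * (s.map (· ^ (n + k))).sum =
      (s.map fun w ↦ w ^ n * P.eval w).sum := by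
  induction s using Multiset.induction with
  | empty => simp
  | cons w s ih =>
    simp only [Multiset.map_cons, Multiset.sum_cons, mul_add, Finset.sum_add_distrib, ih]
    rw [eval_eq_sum_range, Finset.mul_sum]
    congr 1
    exact Finset.sum_congr rfl fun k _ ↦ by ring

/-- If the power sums of a multiset of complex numbers are bounded, then all its elements lie in
the closed unit disc. -/
lemma norm_le_one_of_powerSums_bounded (s : Multiset ℂ) (B : ℝ) (n₀ : ℕ)
    (h : ∀ n ≥ n₀, ‖(s.map (· ^ n)).sum‖ ≤ B) {u : ℂ} (hu : u ∈ s) : ‖u‖ ≤ 1 := by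
  classical
  by_contra! hlt
  set P : ℂ[X] := ∏ v ∈ s.toFinset.erase u, (X - C v) with hP
  have hPu : P.eval u ≠ 0 := by
    rw [hP, eval_prod, Finset.prod_ne_zero_iff]
    intro v hv
    simpa [sub_eq_zero] using (Finset.ne_of_mem_erase hv).symm
  have hPv : ∀ v ∈ s, v ≠ u → P.eval v = 0 := by
    intro v hv hvu
    rw [hP, eval_prod]
    exact Finset.prod_eq_zero (i := v) (by simp [hv, hvu]) (by simp)
  have hsum : ∀ n, (s.map fun w ↦ w ^ n * P.eval w).sum = s.count u * (u ^ n * P.eval u) := by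
    intro n
    rw [Finset.sum_multiset_map_count, Finset.sum_eq_single u]
    · simp
    · intro v hv hvu
      simp [hPv v (by simpa using hv) hvu]
    · intro h'
      simp [hu] at h'
  set B' := ∑ k ∈ Finset.range (P.natDegree + 1), ‖P.coeff k‖ * B with hB'
  have hbound : ∀ n ≥ n₀, ‖u‖ ^ n * ‖P.eval u‖ ≤ B' := by
    intro n hn
    have h1 : ‖(s.map fun w ↦ w ^ n * P.eval w).sum‖ ≤ B' := by
      rw [← sum_coeff_mul_powerSum]
      refine (norm_sum_le _ _).trans (Finset.sum_le_sum fun k _ ↦ ?_)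
      rw [norm_mul]
      exact mul_le_mul_of_nonneg_left (h _ (by omega)) (norm_nonneg _)
    have h2 : (1 : ℝ) ≤ s.count u := by exact_mod_cast Multiset.one_le_count_iff_mem.2 hu
    rw [hsum, norm_mul, norm_mul, norm_pow, Complex.norm_natCast] at h1
    have h3 : 0 ≤ ‖u‖ ^ n * ‖P.eval u‖ := by positivity
    nlinarith
  have hpos : 0 < ‖P.eval u‖ := norm_pos_iff.2 hPu
  obtain ⟨n, hn⟩ := pow_unbounded_of_one_lt (B' / ‖P.eval u‖) hlt
  have h1 := hbound (max n n₀) (le_max_right _ _)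
  have h2 : ‖u‖ ^ n ≤ ‖u‖ ^ (max n n₀) := pow_le_pow_right₀ hlt.le (le_max_left _ _)
  rw [div_lt_iff₀ hpos] at hn
  nlinarith

lemma mul_esymm_eq_neg_sum (s : Multiset ℂ) (n : ℕ) :
    (n : ℂ) * ((-1) ^ n * s.esymm n) =
      -∑ a ∈ Finset.HasAntidiagonal.antidiagonal n with a.1 < n,
        (-1) ^ a.1 * s.esymm a.1 * (s.map (· ^ a.2)).sum := by
  obtain ⟨l, rfl⟩ : ∃ l : List ℂ, (l : Multiset ℂ) = s := ⟨s.toList, s.coe_toList⟩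
  have hl : (Finset.univ : Finset (Fin l.length)).val.map l.get = (l : Multiset ℂ) := by
    rw [Fin.univ_val_map, List.ofFn_get]
  have := congrArg (MvPolynomial.aeval l.get) (MvPolynomial.mul_esymm_eq_sum (Fin l.length) ℂ n)
  simp only [map_mul, map_natCast, map_sum, map_pow, map_neg, map_one,
    MvPolynomial.aeval_esymm_eq_multiset_esymm, hl, MvPolynomial.psum, MvPolynomial.aeval_X] at this
  rw [mul_left_comm, this, ← mul_assoc, ← pow_add, show n + (n + 1) = 2 * n + 1 by ring, pow_succ,
    pow_mul]
  simp only [even_two, Even.neg_pow, one_pow, mul_neg, mul_one, neg_mul, one_mul, neg_inj]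
  refine Finset.sum_congr rfl fun a _ ↦ ?_
  rw [← hl, Multiset.map_map]
  rfl

/-- A sequence `S` related by Newton's identities to the coefficients `a` of a polynomial of degree
less than `m` is given by power sums of `m - 1` complex numbers. -/
lemma exists_roots_of_newton {m : ℕ} (hm : 0 < m) (a S : ℕ → ℂ) (ha0 : a 0 = 1)
    (ha : ∀ n ≥ m, a n = 0)
    (hS : ∀ n : ℕ, (n : ℂ) * a n =
      ∑ x ∈ Finset.HasAntidiagonal.antidiagonal n with x.1 < n, a x.1 * S x.2) :
    ∃ s : Multiset ℂ, s.card = m - 1 ∧ ∀ n, 0 < n → S n = -(s.map (· ^ n)).sum := by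
  set P : ℂ[X] := ∑ i ∈ Finset.range m, C (a i) * X ^ (m - 1 - i) with hP
  have hcoeff : ∀ k < m, P.coeff (m - 1 - k) = a k := by
    intro k hk
    rw [hP, finsetSum_coeff, Finset.sum_eq_single k]
    · simp
    · intro b hb hbk
      rw [coeff_C_mul, coeff_X_pow, if_neg, mul_zero]
      have := Finset.mem_range.1 hb
      omega
    · intro h
      exact absurd (Finset.mem_range.2 hk) h
  have hle : P.natDegree ≤ m - 1 :=
    natDegree_sum_le_of_forall_le _ _ fun i _ ↦ (natDegree_C_mul_X_pow_le _ _).trans (by omega)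
  have htop : P.coeff (m - 1) = 1 := by simpa [ha0] using hcoeff 0 hm
  have hdeg : P.natDegree = m - 1 :=
    le_antisymm hle (le_natDegree_of_ne_zero (by rw [htop]; exact one_ne_zero))
  have hmonic : P.leadingCoeff = 1 := by rw [leadingCoeff, hdeg, htop]
  have hcard : P.roots.card = P.natDegree :=
    (splits_iff_card_roots.1 (IsAlgClosed.splits P))
  have hesymm : ∀ n, a n = (-1) ^ n * P.roots.esymm n := by
    intro n
    by_cases hn : n < m
    · rw [← hcoeff n hn, coeff_eq_esymm_roots_of_card hcard (by omega), hmonic, hdeg,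
        show m - 1 - (m - 1 - n) = n by omega, one_mul]
    · rw [ha n (by omega), Multiset.esymm, Multiset.powersetCard_eq_empty _ (by omega)]
      simp
  refine ⟨P.roots, hcard.trans hdeg, fun n ↦ ?_⟩
  induction n using Nat.strong_induction_on with
  | _ n ih =>
    intro hn
    have h1 := mul_esymm_eq_neg_sum P.roots n
    rw [← hesymm, hS, ← Finset.sum_neg_distrib] at h1
    have h0 : (0, n) ∈ (Finset.HasAntidiagonal.antidiagonal n).filter fun x ↦ x.1 < n := by
      simp [hn]
    rw [← Finset.add_sum_erase _ _ h0, ← Finset.add_sum_erase _ _ h0] at h1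
    have h2 : ∀ x ∈ ((Finset.HasAntidiagonal.antidiagonal n).filter fun x ↦ x.1 < n).erase (0, n),
        a x.1 * S x.2 = -((-1) ^ x.1 * P.roots.esymm x.1 * (P.roots.map (· ^ x.2)).sum) := by
      rintro ⟨i, j⟩ hx
      simp only [Finset.mem_erase, ne_eq, Prod.mk.injEq, Finset.mem_filter,
        Finset.HasAntidiagonal.mem_antidiagonal] at hx
      simp only
      rw [ih j (by omega) (by omega), hesymm]
      ring
    rw [Finset.sum_congr rfl h2, add_left_inj] at h1
    simpa [ha0, Multiset.esymm] using h1

end PowerSums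

section NewtonIdentity

open Finset.HasAntidiagonal (antidiagonal mem_antidiagonal)

variable {F : Type*} [Field F] [Fintype F]

lemma finite_monics (F : Type*) [Field F] [Fintype F] (n : ℕ) :
    {g : F[X] | g.Monic ∧ g.natDegree = n}.Finite := by
  have : Finite (degreeLT F (n + 1) : Set F[X]) := finite_degreeLT (n + 1)
  refine (Set.toFinite (degreeLT F (n + 1) : Set F[X])).subset fun g hg ↦ ?_
  rw [SetLike.mem_coe, mem_degreeLT]
  exact lt_of_le_of_lt degree_le_natDegree (by exact_mod_cast hg.2.trans_lt n.lt_succ_self)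

/-- The monic polynomials of degree `n`. -/
noncomputable def monics (F : Type*) [Field F] [Fintype F] (n : ℕ) : Finset F[X] :=
  (finite_monics F n).toFinset

lemma mem_monics {n : ℕ} {g : F[X]} : g ∈ monics F n ↔ g.Monic ∧ g.natDegree = n := by
  simp [monics]

open scoped Classical in
/-- The monic irreducible polynomials whose degree divides `n`, for `n` positive. -/
noncomputable def primesDvd (F : Type*) [Field F] [Fintype F] (n : ℕ) : Finset F[X] :=
  ((Finset.range (n + 1)).biUnion (monics F)).filter fun P ↦ Irreducible P ∧ P.natDegree ∣ n

lemma mem_primesDvd {n : ℕ} (hn : n ≠ 0) {P : F[X]} :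
    P ∈ primesDvd F n ↔ P.Monic ∧ Irreducible P ∧ P.natDegree ∣ n := by
  simp only [primesDvd, Finset.mem_filter, Finset.mem_biUnion, Finset.mem_range, mem_monics]
  constructor
  · rintro ⟨⟨i, -, h, -⟩, h'⟩
    exact ⟨h, h'⟩
  · rintro ⟨h, h'⟩
    exact ⟨⟨P.natDegree, Nat.lt_succ_of_le (Nat.le_of_dvd (by omega) h'.2), h, rfl⟩, h'⟩

omit [Fintype F] in
open scoped Classical in
lemma sum_count_normalizedFactors_mul_natDegree {g : F[X]} (hg : g.Monic) :
    ∑ P ∈ (UniqueFactorizationMonoid.normalizedFactors g).toFinset,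
      (UniqueFactorizationMonoid.normalizedFactors g).count P * P.natDegree = g.natDegree := by
  have h1 := leadingCoeff_mul_prod_normalizedFactors g
  rw [hg.leadingCoeff, C_1, one_mul] at h1
  have h2 := natDegree_multiset_prod_of_monic (UniqueFactorizationMonoid.normalizedFactors g)
    fun P hP ↦ by
      rw [← UniqueFactorizationMonoid.normalize_normalized_factor P hP]
      exact monic_normalize
        (UniqueFactorizationMonoid.irreducible_of_normalized_factor P hP).ne_zero
  rw [h1, Finset.sum_multiset_map_count] at h2
  simpa using h2.symm

open scoped Classical in
lemma sum_natDegree_of_pow_dvd {n : ℕ} {g : F[X]} (hg : g ∈ monics F n) :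
    ∑ x ∈ antidiagonal n with x.1 < n, ∑ P ∈ primesDvd F x.2 with P ^ (x.2 / P.natDegree) ∣ g,
      P.natDegree = n := by
  obtain ⟨hgm, rfl⟩ := mem_monics.1 hg
  set s := UniqueFactorizationMonoid.normalizedFactors g with hs
  have hdvd : ∀ {P : F[X]} {k : ℕ}, Irreducible P → P.Monic → (P ^ k ∣ g ↔ k ≤ s.count P) := by
    intro P k hP hPm
    have := UniqueFactorizationMonoid.emultiplicity_eq_count_normalizedFactors hP hgm.ne_zero
    rw [hPm.normalize_eq_self] at this
    rw [pow_dvd_iff_le_emultiplicity, this]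
    exact_mod_cast Iff.rfl
  have hmem : ∀ P ∈ s, Irreducible P ∧ P.Monic := fun P hP ↦
    ⟨UniqueFactorizationMonoid.irreducible_of_normalized_factor P hP, by
      rw [← UniqueFactorizationMonoid.normalize_normalized_factor P hP]
      exact monic_normalize
        (UniqueFactorizationMonoid.irreducible_of_normalized_factor P hP).ne_zero⟩
  have hle : ∀ P ∈ s, s.count P * P.natDegree ≤ g.natDegree := by
    intro P hP
    have h := natDegree_le_of_dvd (((hdvd (hmem P hP).1 (hmem P hP).2).2 le_rfl)) hgm.ne_zero
    rwa [natDegree_pow] at h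
  trans ∑ P ∈ s.toFinset, ∑ k ∈ Finset.Icc 1 (s.count P), P.natDegree
  · rw [Finset.sum_sigma', Finset.sum_sigma']
    refine Finset.sum_bij' (fun y _ ↦ ⟨y.2, y.1.2 / y.2.natDegree⟩)
      (fun y _ ↦ ⟨(g.natDegree - y.2 * y.1.natDegree, y.2 * y.1.natDegree), y.1⟩) ?_ ?_ ?_ ?_ ?_
    · rintro ⟨⟨i, j⟩, P⟩ h
      simp only [Finset.mem_sigma, Finset.mem_filter, mem_antidiagonal] at h
      obtain ⟨⟨hij, hi⟩, hP, hPg⟩ := h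
      have hj : j ≠ 0 := by omega
      obtain ⟨hPm, hPi, hPd⟩ := (mem_primesDvd hj).1 hP
      have h1 : 1 ≤ j / P.natDegree :=
        Nat.div_pos (Nat.le_of_dvd (by omega) hPd) hPi.natDegree_pos
      have h2 := (hdvd hPi hPm).1 hPg
      simp only [Finset.mem_sigma, Multiset.mem_toFinset, Finset.mem_Icc]
      exact ⟨Multiset.one_le_count_iff_mem.1 (h1.trans h2), h1, h2⟩
    · rintro ⟨P, k⟩ h
      simp only [Finset.mem_sigma, Multiset.mem_toFinset, Finset.mem_Icc] at h
      obtain ⟨hP, hk1, hk⟩ := h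
      obtain ⟨hPi, hPm⟩ := hmem P hP
      have h1 := hle P hP
      have h2 : k * P.natDegree ≤ s.count P * P.natDegree := Nat.mul_le_mul_right _ hk
      have h3 : 0 < k * P.natDegree := Nat.mul_pos hk1 hPi.natDegree_pos
      simp only [Finset.mem_sigma, Finset.mem_filter, mem_antidiagonal]
      refine ⟨⟨by omega, by omega⟩, (mem_primesDvd h3.ne').2 ⟨hPm, hPi, Dvd.intro_left _ rfl⟩, ?_⟩
      rw [Nat.mul_div_cancel _ hPi.natDegree_pos]
      exact (hdvd hPi hPm).2 hk
    · rintro ⟨⟨i, j⟩, P⟩ h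
      simp only [Finset.mem_sigma, Finset.mem_filter, mem_antidiagonal] at h
      obtain ⟨⟨hij, hi⟩, hP, hPg⟩ := h
      obtain ⟨hPm, hPi, hPd⟩ := (mem_primesDvd (by omega)).1 hP
      simp only [Nat.div_mul_cancel hPd]
      congr 2
      omega
    · rintro ⟨P, k⟩ h
      simp only [Finset.mem_sigma, Multiset.mem_toFinset, Finset.mem_Icc] at h
      simp only [Nat.mul_div_cancel _ (hmem P h.1).1.natDegree_pos]
    · simp
  · simp only [Finset.sum_const, Nat.card_Icc, Nat.add_sub_cancel, smul_eq_mul]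
    exact sum_count_normalizedFactors_mul_natDegree hgm

open scoped Classical in
lemma sum_monics_pow_dvd (φ : F[X] →* ℂ) {i j : ℕ} {P : F[X]} (hj : j ≠ 0)
    (hP : P ∈ primesDvd F j) :
    ∑ g ∈ monics F (i + j) with P ^ (j / P.natDegree) ∣ g, φ g =
      (∑ g ∈ monics F i, φ g) * φ P ^ (j / P.natDegree) := by
  obtain ⟨hPm, hPi, hPd⟩ := (mem_primesDvd hj).1 hP
  have hm : (P ^ (j / P.natDegree)).Monic := hPm.pow _
  have hd : (P ^ (j / P.natDegree)).natDegree = j := by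
    rw [natDegree_pow, Nat.div_mul_cancel hPd]
  rw [Finset.sum_mul]
  symm
  refine Finset.sum_bij (fun g _ ↦ P ^ (j / P.natDegree) * g) ?_ ?_ ?_ ?_
  · intro g hg
    obtain ⟨hgm, rfl⟩ := mem_monics.1 hg
    rw [Finset.mem_filter, mem_monics]
    exact ⟨⟨hm.mul hgm, by rw [hm.natDegree_mul hgm, hd, add_comm]⟩, dvd_mul_right _ _⟩
  · intro g _ h _ hgh
    exact mul_left_cancel₀ hm.ne_zero hgh
  · intro g hg
    rw [Finset.mem_filter, mem_monics] at hg
    obtain ⟨⟨hgm, hgd⟩, h, rfl⟩ := hg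
    have hh : h.Monic := hm.of_mul_monic_left hgm
    rw [hm.natDegree_mul hh, hd] at hgd
    exact ⟨h, mem_monics.2 ⟨hh, by omega⟩, rfl⟩
  · intro g _
    rw [map_mul, map_pow, mul_comm]

/-- The von Mangoldt sums attached to a completely multiplicative function on polynomials. -/
noncomputable def mangoldtSum (φ : F[X] →* ℂ) (j : ℕ) : ℂ :=
  ∑ P ∈ primesDvd F j, P.natDegree * φ P ^ (j / P.natDegree)

lemma natCast_mul_sum_monics (φ : F[X] →* ℂ) (n : ℕ) :
    (n : ℂ) * ∑ g ∈ monics F n, φ g =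
      ∑ x ∈ antidiagonal n with x.1 < n, (∑ g ∈ monics F x.1, φ g) * mangoldtSum φ x.2 := by
  classical
  trans ∑ g ∈ monics F n, ∑ x ∈ antidiagonal n with x.1 < n,
    ∑ P ∈ primesDvd F x.2 with P ^ (x.2 / P.natDegree) ∣ g, (P.natDegree : ℂ) * φ g
  · rw [Finset.mul_sum]
    refine Finset.sum_congr rfl fun g hg ↦ ?_
    simp_rw [← Finset.sum_mul]
    congr 1
    exact_mod_cast (sum_natDegree_of_pow_dvd hg).symm
  · rw [Finset.sum_comm]
    refine Finset.sum_congr rfl fun x hx ↦ ?_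
    obtain ⟨i, j⟩ := x
    simp only [Finset.mem_filter, mem_antidiagonal] at hx
    obtain ⟨rfl, hj⟩ := hx
    simp_rw [Finset.sum_filter]
    rw [Finset.sum_comm, mangoldtSum, Finset.mul_sum]
    refine Finset.sum_congr rfl fun P hP ↦ ?_
    rw [← Finset.sum_filter, ← Finset.mul_sum, sum_monics_pow_dvd φ (by omega) hP]
    ring

end NewtonIdentity

section ResultantCharacter

variable {F : Type*} [Field F]

lemma algebraMap_resultant {f : F[X]} (hf : f.Monic) (g : F[X]) :
    algebraMap F (AlgebraicClosure F) (resultant f g) =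
      ((f.aroots (AlgebraicClosure F)).map fun α ↦ aeval α g).prod := by
  have h := resultant_eq_prod_eval (f.map (algebraMap F (AlgebraicClosure F)))
    (g.map (algebraMap F (AlgebraicClosure F))) g.natDegree natDegree_map_le
    (IsAlgClosed.splits _)
  rw [natDegree_map, resultant_map_map, (hf.map _).leadingCoeff, one_pow, one_mul] at h
  simpa only [eval_map_algebraMap] using h

lemma resultant_eq_resultant_of_dvd_sub {f g h : F[X]} (hf : f.Monic) (hd : f ∣ g - h) :
    resultant f g = resultant f h := by
  apply (algebraMap F (AlgebraicClosure F)).injective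
  rw [algebraMap_resultant hf, algebraMap_resultant hf]
  congr 1
  refine Multiset.map_congr rfl fun α hα ↦ ?_
  obtain ⟨k, hk⟩ := hd
  rw [← sub_eq_zero, ← map_sub, hk, map_mul, (mem_aroots.1 hα).2, zero_mul]

/-- The resultant with a fixed monic polynomial, as a monoid homomorphism. -/
noncomputable def resultantHom {f : F[X]} (hf : f.Monic) : F[X] →* F where
  toFun g := resultant f g
  map_one' := by
    apply (algebraMap F (AlgebraicClosure F)).injective
    rw [algebraMap_resultant hf]
    simp
  map_mul' g h := by
    apply (algebraMap F (AlgebraicClosure F)).injective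
    simp only [map_mul, algebraMap_resultant hf, Multiset.prod_map_mul]

lemma resultantHom_apply {f : F[X]} (hf : f.Monic) (g : F[X]) :
    resultantHom hf g = resultant f g := rfl

lemma norm_aeval_gen_eq_resultant {L : Type*} [Field L] [Algebra F L] [FiniteDimensional F L]
    [Algebra.IsSeparable F L] (pb : PowerBasis F L) (g : F[X]) :
    Algebra.norm F (aeval pb.gen g) = resultant (minpoly F pb.gen) g := by
  classical
  apply (algebraMap F (AlgebraicClosure F)).injective
  rw [algebraMap_resultant (minpoly.monic pb.isIntegral_gen), Algebra.norm_eq_prod_embeddings]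
  have hnd : ((minpoly F pb.gen).aroots (AlgebraicClosure F)).Nodup :=
    nodup_aroots_iff_of_splits (minpoly.ne_zero pb.isIntegral_gen) (IsAlgClosed.splits _) |>.2
      (Algebra.IsSeparable.isSeparable F pb.gen)
  rw [Fintype.prod_equiv pb.liftEquiv' (fun σ ↦ σ (aeval pb.gen g))
    (fun y ↦ aeval (y : AlgebraicClosure F) g) (fun σ ↦ by
      rw [← aeval_algHom_apply]; rfl)]
  rw [Finset.prod_mem_multiset _ _ (fun y ↦ aeval y g) (fun y ↦ rfl),
    Finset.prod_eq_multiset_prod, Multiset.toFinset_val, Multiset.dedup_eq_self.mpr hnd]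

variable [Fintype F] [DecidableEq F]

/-- The quadratic character modulo a monic polynomial. -/
noncomputable def resultantChar {f : F[X]} (hf : f.Monic) : F[X] →* ℂ :=
  ((Int.castRingHom ℂ : ℤ →* ℂ).comp (quadraticChar F).toMonoidHom).comp (resultantHom hf)

lemma resultantChar_apply {f : F[X]} (hf : f.Monic) (g : F[X]) :
    resultantChar hf g = (quadraticChar F (resultant f g) : ℤ) := rfl

lemma exists_resultantChar_eq_neg_one (hF : ringChar F ≠ 2) {f : F[X]} (hf : f.Monic)
    (hsq : Squarefree f) (hdeg : 0 < f.natDegree) : ∃ u, resultantChar hf u = -1 := by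
  obtain ⟨P, hP, hPi, h, rfl⟩ :=
    exists_monic_irreducible_factor f (not_isUnit_of_natDegree_pos f hdeg)
  have hh : h.Monic := hP.of_mul_monic_left hf
  obtain ⟨a, b, hab⟩ := (IsRelPrime.of_squarefree_mul hsq).isCoprime
  obtain ⟨z, hz⟩ := quadraticChar_exists_neg_one hF
  have : Fact (Irreducible P) := ⟨hPi⟩
  set pb := AdjoinRoot.powerBasis hP.ne_zero
  have : FiniteDimensional F (AdjoinRoot P) := pb.finite
  have : Finite (AdjoinRoot P) := Module.finite_of_finite F
  obtain ⟨θ, hθ⟩ := FiniteField.norm_surjective F (AdjoinRoot P) z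
  obtain ⟨t, rfl⟩ := AdjoinRoot.mk_surjective θ
  have hres : resultant P t = z := by
    have h := norm_aeval_gen_eq_resultant pb t
    rw [AdjoinRoot.minpoly_powerBasis_gen_of_monic hP, AdjoinRoot.powerBasis_gen,
      AdjoinRoot.aeval_eq, hθ] at h
    exact h.symm
  set u := 1 + (t - 1) * (b * h) with hu
  have hmul : resultant (P * h) u = resultant P u * resultant h u := by
    apply (algebraMap F (AlgebraicClosure F)).injective
    rw [map_mul, algebraMap_resultant hf, algebraMap_resultant hP, algebraMap_resultant hh,
      aroots_mul hf.ne_zero, Multiset.map_add, Multiset.prod_add]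
  have h1 : resultant P u = z := by
    rw [← hres]
    refine resultant_eq_resultant_of_dvd_sub hP ⟨-(t - 1) * a, ?_⟩
    rw [hu]
    linear_combination (t - 1) * hab
  have h2 : resultant h u = 1 := by
    rw [← map_one (resultantHom hh), resultantHom_apply]
    exact resultant_eq_resultant_of_dvd_sub hh ⟨(t - 1) * b, by rw [hu]; ring⟩
  refine ⟨u, ?_⟩
  rw [resultantChar_apply, hmul, h1, h2, mul_one, hz]
  simp

lemma sum_resultantChar_eq_zero (hF : ringChar F ≠ 2) {f : F[X]} (hf : f.Monic)
    (hsq : Squarefree f) (hdeg : 0 < f.natDegree) {n : ℕ} (hn : f.natDegree ≤ n) :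
    ∑ g ∈ monics F n, resultantChar hf g = 0 := by
  classical
  obtain ⟨u, hu⟩ := exists_resultantChar_eq_neg_one hF hf hsq hdeg
  have hcop : IsCoprime f u := by
    rw [← isUnit_resultant_iff_isCoprime hf, isUnit_iff_ne_zero]
    intro h
    rw [resultantChar_apply, h] at hu
    simp at hu
  set σ : F[X] → F[X] := fun g ↦ g + ((u - 1) * g) %ₘ f with hσ
  have hσd : ∀ g, f ∣ σ g - u * g := fun g ↦
    ⟨-(((u - 1) * g) /ₘ f), by linear_combination modByMonic_add_div ((u - 1) * g) f⟩
  have hlt : ∀ g : F[X], (g %ₘ f).degree < f.degree := fun g ↦ degree_modByMonic_lt g hf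
  have hmap : ∀ g ∈ monics F n, σ g ∈ monics F n := by
    intro g hg
    obtain ⟨hgm, rfl⟩ := mem_monics.1 hg
    have h1 : (((u - 1) * g) %ₘ f).degree < g.degree :=
      (hlt _).trans_le <| by
        rw [degree_eq_natDegree hf.ne_zero, degree_eq_natDegree hgm.ne_zero]
        exact_mod_cast hn
    exact mem_monics.2 ⟨hgm.add_of_left h1, natDegree_add_eq_left_of_degree_lt h1⟩
  have hinj : Set.InjOn σ (monics F n) := by
    intro g _ h _ hgh
    have h1 : f ∣ u * (g - h) := by
      have := dvd_sub (hσd h) (hσd g)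
      rw [hgh] at this
      convert this using 1
      ring
    have h2 : f ∣ g - h := hcop.dvd_of_dvd_mul_left h1
    have h3 : g - h = ((u - 1) * h) %ₘ f - ((u - 1) * g) %ₘ f := by
      have hgh' : g + ((u - 1) * g) %ₘ f = h + ((u - 1) * h) %ₘ f := hgh
      linear_combination hgh'
    have h4 : (g - h).degree < f.degree := by
      rw [h3]
      exact (degree_sub_le _ _).trans_lt (max_lt (hlt _) (hlt _))
    exact sub_eq_zero.1 (eq_zero_of_dvd_of_degree_lt h2 h4)
  have himg : (monics F n).image σ = monics F n :=
    Finset.eq_of_subset_of_card_le (Finset.image_subset_iff.2 hmap)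
      (Finset.card_image_of_injOn hinj).ge
  have hsum : ∑ g ∈ monics F n, resultantChar hf g = -∑ g ∈ monics F n, resultantChar hf g := by
    conv_lhs => rw [← himg, Finset.sum_image hinj]
    rw [← Finset.sum_neg_distrib]
    refine Finset.sum_congr rfl fun g _ ↦ ?_
    have : resultantChar hf (σ g) = resultantChar hf (u * g) := by
      rw [resultantChar_apply, resultantChar_apply, resultant_eq_resultant_of_dvd_sub hf (hσd g)]
    rw [this, map_mul, hu, neg_one_mul]
  linear_combination hsum / 2

end ResultantCharacter

section Extension

variable {F K : Type*} [Field F] [Fintype F] [DecidableEq F] [Field K] [Fintype K] [DecidableEq K]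
  [Algebra F K]

lemma quadraticChar_norm (hF : ringChar F ≠ 2) (x : K) :
    quadraticChar F (Algebra.norm F x) = quadraticChar K x := by
  have hK : ringChar K ≠ 2 := by
    rwa [← Algebra.ringChar_eq F K]
  obtain rfl | hx := eq_or_ne x 0
  · simp
  have hN : Algebra.norm F x ≠ 0 := Algebra.norm_ne_zero_iff.2 hx
  have hcard : Fintype.card K = Fintype.card F ^ Module.finrank F K := Module.card_eq_pow_finrank
  have hoddF : Odd (Fintype.card F) := by
    rw [← Nat.not_even_iff_odd, Nat.even_iff]
    exact fun h ↦ hF (FiniteField.even_card_iff_char_two.2 h)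
  have hoddK : Odd (Fintype.card K) := hcard ▸ hoddF.pow
  have hdvd : Fintype.card F - 1 ∣ Fintype.card K - 1 := by
    simpa [hcard] using Nat.sub_dvd_pow_sub_pow (Fintype.card F) 1 (Module.finrank F K)
  have h1 : ((quadraticChar F (Algebra.norm F x) : ℤ) : K) = ((quadraticChar K x : ℤ) : K) := by
    rw [quadraticChar_eq_pow_of_char_ne_two' hK, ← map_intCast (algebraMap F K),
      quadraticChar_eq_pow_of_char_ne_two' hF, map_pow, FiniteField.algebraMap_norm_eq_pow,
      ← pow_mul, Nat.card_eq_fintype_card, Nat.card_eq_fintype_card]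
    congr 1
    obtain ⟨a, ha⟩ := hdvd
    obtain ⟨b, hb⟩ := hoddF
    obtain ⟨c, hc⟩ := hoddK
    have hb0 : 0 < b := by
      have := Fintype.one_lt_card (α := F)
      omega
    rw [ha, Nat.mul_div_cancel_left _ (by omega)]
    have h2 : 2 * c = 2 * b * a := by
      rw [hc, hb] at ha
      simpa using ha
    have h3 : c = b * a := by
      rw [mul_assoc] at h2
      omega
    rw [hc, hb, show (2 * b + 1) / 2 = b by omega, show (2 * c + 1) / 2 = c by omega, h3, mul_comm]
  have h2 : (1 : K) ≠ -1 := (Ring.neg_one_ne_one_of_char_ne_two hK).symm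
  rcases quadraticChar_dichotomy hN with h | h <;>
    rcases quadraticChar_dichotomy hx with h' | h' <;>
    rw [h, h'] at h1 ⊢ <;> simp_all

omit [DecidableEq F] [DecidableEq K] in
lemma norm_aeval_eq_resultant (f : F[X]) (c : K) :
    Algebra.norm F (aeval c f) =
      resultant (minpoly F c) f ^ (Module.finrank F K / (minpoly F c).natDegree) := by
  have hc : IsIntegral F c := Algebra.IsIntegral.isIntegral c
  have h1 := norm_aeval_gen_eq_resultant (IntermediateField.adjoin.powerBasis hc) f
  rw [IntermediateField.adjoin.powerBasis_gen, IntermediateField.minpoly_gen] at h1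
  have h2 : aeval c f = algebraMap (IntermediateField.adjoin F {c}) K
      (aeval (IntermediateField.AdjoinSimple.gen F c) f) := by
    rw [← aeval_algebraMap_apply, IntermediateField.AdjoinSimple.algebraMap_gen]
  have h3 : Module.finrank F K / (minpoly F c).natDegree =
      Module.finrank (IntermediateField.adjoin F {c}) K := by
    rw [← IntermediateField.adjoin.finrank hc,
      ← Module.finrank_mul_finrank F (IntermediateField.adjoin F {c}) K,
      Nat.mul_div_cancel_left _ Module.finrank_pos]
  rw [h2, ← Algebra.norm_norm (S := IntermediateField.adjoin F {c}), Algebra.norm_algebraMap,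
    map_pow, h1, h3]

lemma card_filter_minpoly_eq {P : F[X]} (hP : P ∈ primesDvd F (Module.finrank F K)) :
    (Finset.univ.filter fun c : K ↦ minpoly F c = P).card = P.natDegree := by
  obtain ⟨hPm, hPi, hPd⟩ := (mem_primesDvd Module.finrank_pos.ne').1 hP
  have hdvd : P ∣ X ^ Fintype.card K - X := by
    rw [hPi.natDegree_dvd_iff_dvd_X_pow_card_pow_sub_X, Nat.card_eq_fintype_card,
      ← Module.card_eq_pow_finrank (K := F) (V := K)] at hPd
    exact hPd
  have hsplit : (P.map (algebraMap F K)).Splits := by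
    have h1 := Polynomial.map_dvd (algebraMap F K) hdvd
    refine Splits.of_dvd ?_ (FiniteField.X_pow_card_sub_X_ne_zero K Fintype.one_lt_card)
      (by simpa using h1)
    rw [splits_iff_card_roots, FiniteField.roots_X_pow_card_sub_X,
      FiniteField.X_pow_card_sub_X_natDegree_eq _ Fintype.one_lt_card]
    simp
  have hnd : (P.aroots K).Nodup :=
    (nodup_aroots_iff_of_splits hPi.ne_zero hsplit).2 (PerfectField.separable_of_irreducible hPi)
  have h2 : (Finset.univ.filter fun c : K ↦ minpoly F c = P) = (P.aroots K).toFinset := by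
    ext c
    simp only [Finset.mem_filter, Finset.mem_univ, true_and, Multiset.mem_toFinset, mem_aroots]
    constructor
    · rintro rfl
      exact ⟨hPi.ne_zero, minpoly.aeval F c⟩
    · rintro ⟨-, h⟩
      exact (minpoly.eq_of_irreducible_of_monic hPi h hPm).symm
  rw [h2, Multiset.toFinset_card_of_nodup hnd, ← natDegree_map (algebraMap F K),
    hsplit.natDegree_eq_card_roots]

/-- Character sums over an extension field are von Mangoldt sums over the base field. -/
lemma norm_sum_quadraticChar_eq (hF : ringChar F ≠ 2) {f : F[X]} (hf : f.Monic) :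
    ‖((∑ c : K, quadraticChar K (aeval c f) : ℤ) : ℂ)‖ =
      ‖mangoldtSum (resultantChar hf) (Module.finrank F K)‖ := by
  classical
  set j := Module.finrank F K with hj
  have hj0 : j ≠ 0 := Module.finrank_pos.ne'
  set ε : ℂ := ((quadraticChar F (-1) : ℤ) : ℂ) with hε
  have hmem : ∀ c : K, minpoly F c ∈ primesDvd F j := fun c ↦
    have hc : IsIntegral F c := Algebra.IsIntegral.isIntegral c
    (mem_primesDvd hj0).2 ⟨minpoly.monic hc, minpoly.irreducible hc, minpoly.degree_dvd hc⟩
  have hval : ∀ c : K, ((quadraticChar K (aeval c f) : ℤ) : ℂ) =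
      ε ^ (f.natDegree * j) *
        resultantChar hf (minpoly F c) ^ (j / (minpoly F c).natDegree) := by
    intro c
    have hd := ((mem_primesDvd hj0).1 (hmem c)).2.2
    rw [← quadraticChar_norm hF, norm_aeval_eq_resultant, ← hj, resultant_comm,
      resultantChar_apply, map_pow, map_mul, map_pow, hε, mul_pow]
    push_cast
    rw [← pow_mul]
    congr 2
    rw [mul_comm (minpoly F c).natDegree, mul_assoc, Nat.mul_div_cancel' hd]
  have hsum : ((∑ c : K, quadraticChar K (aeval c f) : ℤ) : ℂ) =
      ε ^ (f.natDegree * j) * mangoldtSum (resultantChar hf) j := by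
    push_cast
    rw [Finset.sum_congr rfl fun c _ ↦ hval c, ← Finset.mul_sum, mangoldtSum,
      ← Finset.sum_fiberwise_of_maps_to fun c _ ↦ hmem c]
    congr 1
    refine Finset.sum_congr rfl fun P hP ↦ ?_
    rw [Finset.sum_congr rfl fun c hc ↦ by rw [(Finset.mem_filter.1 hc).2], Finset.sum_const,
      card_filter_minpoly_eq hP, nsmul_eq_mul]
  have hnorm : ‖ε‖ = 1 := by
    rcases quadraticChar_dichotomy (neg_ne_zero.2 (one_ne_zero (α := F))) with h | h <;>
      simp [hε, h]
  rw [hsum, norm_mul, norm_pow, hnorm, one_pow, one_mul]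

end Extension

section SquarefreeBound

variable {F : Type*} [Field F] [Fintype F] [DecidableEq F]

/-- Over suitable towers of extensions, the character sum has square root cancellation up to a
constant. -/
lemma exists_norm_mangoldtSum_le (hodd : Odd (Fintype.card F)) {f : F[X]} (hf : f.Monic)
    (hsq : Squarefree f) (hdeg : 0 < f.natDegree) :
    ∃ e > 0, ∃ n₀ > 0, ∀ n ≥ n₀, ‖mangoldtSum (resultantChar hf) (2 * e * n)‖ ≤
      (2 * f.natDegree + 2) * (Fintype.card F : ℝ) ^ (e * n) := by
  classical
  have : Finite f.SplittingField := Module.finite_of_finite F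
  let : Fintype f.SplittingField := Fintype.ofFinite _
  obtain ⟨p, hp⟩ := CharP.exists f.SplittingField
  have : Fact p.Prime := ⟨CharP.char_is_prime f.SplittingField p⟩
  obtain ⟨k, -, hk⟩ := FiniteField.card f.SplittingField p
  have hcardE : Fintype.card f.SplittingField =
      Fintype.card F ^ Module.finrank F f.SplittingField := Module.card_eq_pow_finrank
  refine ⟨Module.finrank F f.SplittingField, Module.finrank_pos, (f.natDegree + 2) ^ 2,
    by positivity, fun n hn ↦ ?_⟩
  have hn0 : 0 < n := lt_of_lt_of_le (by positivity) hn
  have : NeZero (2 * n) := ⟨by omega⟩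
  let K := FiniteField.Extension f.SplittingField p (2 * n)
  let : Fintype K := Fintype.ofFinite K
  let : Algebra F K := ((algebraMap f.SplittingField K).comp (algebraMap F _)).toAlgebra
  have : IsScalarTower F f.SplittingField K := IsScalarTower.of_algebraMap_eq fun _ ↦ rfl
  have : CharP K p := charP_of_injective_algebraMap (algebraMap f.SplittingField K).injective p
  have hcardK : Fintype.card K = (Fintype.card f.SplittingField ^ n) ^ 2 := by
    rw [← Nat.card_eq_fintype_card, FiniteField.natCard_extension, Nat.card_eq_fintype_card,
      ← pow_mul, mul_comm]
  have hfinrank : Module.finrank F K = 2 * Module.finrank F f.SplittingField * n := by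
    rw [← Module.finrank_mul_finrank F f.SplittingField K, FiniteField.finrank_extension]
    ring
  have hroot : ∃ α : K, (f.map (algebraMap F K)).rootMultiplicity α = 1 := by
    have hsplit : (f.map (algebraMap F f.SplittingField)).Splits := SplittingField.splits f
    obtain ⟨β, hβ⟩ := hsplit.exists_eval_eq_zero (by
      rw [degree_map, degree_eq_natDegree hf.ne_zero]
      exact_mod_cast hdeg.ne')
    have hsep : f.Separable := PerfectField.separable_iff_squarefree.2 hsq
    refine ⟨algebraMap _ K β, le_antisymm ?_ ?_⟩
    · exact rootMultiplicity_le_one_of_separable (hsep.map) _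
    · refine (rootMultiplicity_pos (map_ne_zero hf.ne_zero)).2 ?_
      rw [IsRoot, eval_map_algebraMap, aeval_algebraMap_apply, ← eval_map_algebraMap, hβ, map_zero]
  obtain ⟨α, hα⟩ := hroot
  have hmain := abs_sum_quadraticChar_le (K := K) p (k * n) (Fintype.card f.SplittingField ^ n)
    (by rw [hk, pow_mul]) (by rw [hcardE]; exact (hodd.pow).pow) hcardK hα (by
      rw [natDegree_map]
      calc (f.natDegree + 2) ^ 2 ≤ n := hn
        _ < 2 ^ n := Nat.lt_two_pow_self
        _ ≤ _ := Nat.pow_le_pow_left Fintype.one_lt_card n)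
  rw [natDegree_map, hcardE, ← pow_mul] at hmain
  have h1 := norm_sum_quadraticChar_eq (K := K) (ringChar_ne_two_of_odd hodd) hf
  rw [hfinrank, Complex.norm_intCast] at h1
  rw [← h1]
  simp only [eval_map_algebraMap] at hmain
  exact_mod_cast hmain

lemma abs_sum_quadraticChar_le_of_squarefree (hodd : Odd (Fintype.card F)) {f : F[X]}
    (hf : f.Monic) (hsq : Squarefree f) (hdeg : 0 < f.natDegree) :
    |((∑ c : F, quadraticChar F (f.eval c) : ℤ) : ℝ)| ≤
      ((f.natDegree : ℝ) - 1) * Real.sqrt (Fintype.card F) := by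
  have hF := ringChar_ne_two_of_odd hodd
  set q : ℝ := (Fintype.card F : ℝ) with hq
  have hq0 : 0 < q := by
    rw [hq]
    exact_mod_cast Fintype.card_pos
  have ha0 : ∑ g ∈ monics F 0, resultantChar hf g = 1 := by
    have : monics F 0 = {1} := by
      ext g
      rw [mem_monics, Finset.mem_singleton]
      exact ⟨fun h ↦ eq_one_of_monic_natDegree_zero h.1 h.2, by rintro rfl; simp⟩
    rw [this, Finset.sum_singleton, map_one]
  obtain ⟨s, hs, hS⟩ := exists_roots_of_newton hdeg
    (fun n ↦ ∑ g ∈ monics F n, resultantChar hf g) (mangoldtSum (resultantChar hf)) ha0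
    (fun n hn ↦ sum_resultantChar_eq_zero hF hf hsq hdeg hn)
    (fun n ↦ natCast_mul_sum_monics (resultantChar hf) n)
  obtain ⟨e, he, n₀, hn₀, hbound⟩ := exists_norm_mangoldtSum_le hodd hf hsq hdeg
  have hω : ∀ ω ∈ s, ‖ω‖ ≤ Real.sqrt q := by
    intro ω hω
    have h1 : ‖ω ^ (2 * e) / (q : ℂ) ^ e‖ ≤ 1 := by
      refine norm_le_one_of_powerSums_bounded
        (s.map fun ω ↦ ω ^ (2 * e) / (q : ℂ) ^ e) (2 * f.natDegree + 2) n₀ (fun n hn ↦ ?_)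
        (Multiset.mem_map_of_mem _ hω)
      have h2 := hbound n hn
      rw [hS _ (by have : 0 < n := by omega
                   positivity), norm_neg, ← hq] at h2
      have h3 : ((s.map fun ω ↦ ω ^ (2 * e) / (q : ℂ) ^ e).map (· ^ n)).sum =
          (s.map (· ^ (2 * e * n))).sum / (q : ℂ) ^ (e * n) := by
        rw [Multiset.map_map, ← Multiset.sum_map_div]
        congr 1
        refine Multiset.map_congr rfl fun ω _ ↦ ?_
        simp only [Function.comp_apply, div_pow, pow_mul]
      rw [h3, norm_div, norm_pow, Complex.norm_real, Real.norm_of_nonneg hq0.le,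
        div_le_iff₀ (by positivity)]
      exact h2
    rw [norm_div, norm_pow, norm_pow, Complex.norm_real, Real.norm_of_nonneg hq0.le,
      div_le_one (by positivity), pow_mul] at h1
    exact Real.le_sqrt_of_sq_le (le_of_pow_le_pow_left₀ he.ne' hq0.le h1)
  have h1 := norm_sum_quadraticChar_eq (F := F) (K := F) hF hf
  rw [Module.finrank_self, hS 1 one_pos, norm_neg, Complex.norm_intCast] at h1
  simp only [coe_aeval_eq_eval, pow_one, Multiset.map_id'] at h1
  rw [h1]
  have h2 : ‖s.sum‖ ≤ (s.map fun ω ↦ ‖ω‖).sum := norm_multiset_sum_le s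
  refine h2.trans ?_
  have h3 := Multiset.sum_le_card_nsmul (s.map fun ω ↦ ‖ω‖) (Real.sqrt q) (by simpa using hω)
  rw [Multiset.card_map, hs, nsmul_eq_mul, Nat.cast_sub hdeg] at h3
  simpa using h3

end SquarefreeBound

section General

lemma exists_eq_squarefree_mul_sq {F : Type*} [Field F] (f : F[X]) (hf : f.Monic) :
    ∃ f₁ h : F[X], f₁.Monic ∧ h.Monic ∧ Squarefree f₁ ∧ f = f₁ * h ^ 2 := by
  induction hn : f.natDegree using Nat.strong_induction_on generalizing f with
  | _ n ih =>
    by_cases hsq : Squarefree f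
    · exact ⟨f, 1, hf, monic_one, hsq, by simp⟩
    obtain ⟨x, hx, hxu⟩ : ∃ x, x * x ∣ f ∧ ¬ IsUnit x := by
      simpa [Squarefree] using hsq
    obtain ⟨P, hP, hPi, hPx⟩ := exists_monic_irreducible_factor x hxu
    obtain ⟨g, rfl⟩ := (mul_dvd_mul hPx hPx).trans hx
    have hg : g.Monic := (hP.mul hP).of_mul_monic_left hf
    have hlt : g.natDegree < n := by
      rw [(hP.mul hP).natDegree_mul hg, hP.natDegree_mul hP] at hn
      have := hPi.natDegree_pos
      omega
    obtain ⟨f₁, h, hf₁, hh, hs, rfl⟩ := ih _ hlt g hg rfl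
    exact ⟨f₁, P * h, hf₁, hP.mul hh, hs, by ring⟩

lemma abs_sum_quadraticChar_mul_sq_sub_le {F : Type*} [Field F] [Fintype F] [DecidableEq F]
    (f h : F[X]) :
    |∑ c : F, quadraticChar F ((f * h ^ 2).eval c) - ∑ c : F, quadraticChar F (f.eval c)| ≤
      (Finset.univ.filter fun c : F ↦ h.eval c = 0 ∧ f.eval c ≠ 0).card := by
  rw [← Finset.sum_sub_distrib, Finset.card_filter]
  push_cast
  refine (Finset.abs_sum_le_sum_abs _ _).trans (Finset.sum_le_sum fun c _ ↦ ?_)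
  simp only [eval_mul, eval_pow, map_mul]
  by_cases hh : h.eval c = 0
  · by_cases hf : f.eval c = 0
    · simp [hf]
    · rcases quadraticChar_dichotomy hf with h' | h' <;> simp [hh, hf, h']
  · simp [quadraticChar_sq_one' hh, hh]

lemma card_filter_add_natDegree_le {F : Type*} [Field F] [Fintype F] [DecidableEq F]
    {E : Type*} [Field E] [Algebra F E] [DecidableEq E] {f h : F[X]} (hf : f.Monic) (hh : h.Monic)
    (hsq : Squarefree f) (hsplit : ((f * h ^ 2).map (algebraMap F E)).Splits) :
    (Finset.univ.filter fun c : F ↦ h.eval c = 0 ∧ f.eval c ≠ 0).card + f.natDegree ≤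
      (((f * h ^ 2).map (algebraMap F E)).roots).toFinset.card := by
  have hne : f * h ^ 2 ≠ 0 := (hf.mul (hh.pow 2)).ne_zero
  have hfs : (f.map (algebraMap F E)).Splits :=
    hsplit.of_dvd (map_ne_zero hne) (Polynomial.map_dvd _ (dvd_mul_right _ _))
  have hnd : (f.aroots E).Nodup := (nodup_aroots_iff_of_splits hf.ne_zero hfs).2
    (PerfectField.separable_iff_squarefree.2 hsq)
  have h1 : f.natDegree = (f.aroots E).toFinset.card := by
    rw [Multiset.toFinset_card_of_nodup hnd, ← natDegree_map (algebraMap F E),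
      hfs.natDegree_eq_card_roots]
  rw [h1, ← Finset.card_map ⟨algebraMap F E, (algebraMap F E).injective⟩,
    ← Finset.card_union_of_disjoint]
  · refine Finset.card_le_card fun x hx ↦ ?_
    simp only [Finset.mem_union, Finset.mem_map, Finset.mem_filter, Finset.mem_univ, true_and,
      Function.Embedding.coeFn_mk, Multiset.mem_toFinset, mem_aroots] at hx
    rw [Multiset.mem_toFinset]
    refine mem_aroots.2 ⟨hne, ?_⟩
    rw [map_mul, map_pow]
    obtain ⟨c, ⟨hc, -⟩, rfl⟩ | hx := hx
    · simp [aeval_algebraMap_apply, coe_aeval_eq_eval, hc]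
    · rw [hx.2, zero_mul]
  · rw [Finset.disjoint_left]
    intro x hx hx'
    simp only [Finset.mem_map, Finset.mem_filter, Finset.mem_univ, true_and,
      Function.Embedding.coeFn_mk] at hx
    obtain ⟨c, ⟨-, hc⟩, rfl⟩ := hx
    rw [Multiset.mem_toFinset, mem_aroots, aeval_algebraMap_apply, coe_aeval_eq_eval] at hx'
    exact hc (by simpa using hx'.2)

end General

end HyperellipticBound

/-- Weil bound for the quadratic character: if `f` is a monic polynomial
of positive degree over `𝔽_q` (`q` odd) which is not the square of a polynomial, and `d`
is the number of distinct roots of `f` in its splitting field, then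
`|∑_{c ∈ 𝔽_q} η(f(c))| ≤ (d - 1)√q`. -/
theorem stmt_12 {F : Type*} [Field F] [Fintype F] [DecidableEq F]
    (hodd : Odd (Fintype.card F))
    (f : Polynomial F) (hmonic : f.Monic) (hdeg : 0 < f.natDegree)
    (hnsq : ¬ ∃ g : Polynomial F, f = g ^ 2)
    (d : ℕ)
    (hd : d = (@Multiset.toFinset _ (Classical.decEq _)
      ((f.map (algebraMap F f.SplittingField)).roots)).card) :
    |((∑ c : F, (quadraticChar F (f.eval c) : ℤ)) : ℝ)| ≤
      ((d : ℝ) - 1) * Real.sqrt (Fintype.card F) := by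
  obtain ⟨f₁, h, hf₁, hh, hsq, rfl⟩ := HyperellipticBound.exists_eq_squarefree_mul_sq f hmonic
  have hdeg₁ : 0 < f₁.natDegree := by
    rw [Nat.pos_iff_ne_zero]
    intro h0
    exact hnsq ⟨h, by rw [Polynomial.eq_one_of_monic_natDegree_zero hf₁ h0, one_mul]⟩
  have h1 := HyperellipticBound.abs_sum_quadraticChar_le_of_squarefree hodd hf₁ hsq hdeg₁
  have h2 := HyperellipticBound.abs_sum_quadraticChar_mul_sq_sub_le f₁ h
  have h3 := @HyperellipticBound.card_filter_add_natDegree_le F _ _ _ _ _ _ (Classical.decEq _)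
    f₁ h hf₁ hh hsq (Polynomial.SplittingField.splits _)
  rw [← hd] at h3
  set z := (Finset.univ.filter fun c : F ↦ h.eval c = 0 ∧ f₁.eval c ≠ 0).card
  have h2' := Int.cast_le (R := ℝ) |>.2 h2
  have h3' : (z : ℝ) + f₁.natDegree ≤ d := by exact_mod_cast h3
  have h4 : 1 ≤ Real.sqrt (Fintype.card F) := by
    rw [Real.one_le_sqrt]
    exact_mod_cast Fintype.card_pos
  rw [Int.cast_abs, Int.cast_sub, Int.cast_natCast] at h2'
  rw [← Int.cast_sum]
  have h5 := abs_sub_abs_le_abs_sub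
    ((∑ c : F, quadraticChar F ((f₁ * h ^ 2).eval c) : ℤ) : ℝ)
    ((∑ c : F, quadraticChar F (f₁.eval c) : ℤ) : ℝ)
  nlinarith [(Nat.cast_nonneg z : (0 : ℝ) ≤ z)]
end
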